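/- (Pseudorandom affine partition) Let P be the n-fold GHZ query distribution, let E = E1×E2×E3 ⊆ (F_2^n)^3 with P(E) = α > 0, and let δ > 0. Then there exists a partition of (F_2^n)^3 into finitely many parts, where each part π has the form (b1+V)×(b2+V)×(b3+V) for some subspace V ⊆ F_2^n of codimension at most 3/δ^3 and some b1,b2,b3 ∈ F_2^n (V may depend on the part), such that with probability at least 1 − δ/α over a sample (x,y,z) ∼ P|E, the part π = (b1+V)×(b2+V)×(b3+V) containing (x,y,z) satisfies: for all i ∈ {1,2,3} and all γ ∈ F_2^n with γ ∉ V^⊥, |(Ê_i)_{b_i}(γ)| ≤ δ. -/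

import Mathlib

/-- Vectors of length `n` over `F_2`. -/
abbrev Vec (n : ℕ) := Fin n → ZMod 2

/-- Inner product `γ · v = Σ_j γ_j v_j` (mod 2). -/
def dot {n : ℕ} (γ v : Vec n) : ZMod 2 := ∑ j, γ j * v j

/-- `(-1)^t` for a bit `t`. -/
def sgn (t : ZMod 2) : ℝ := if t = 0 then 1 else -1

/-- The Fourier coefficient of (the indicator of) the set `S` on the coset `a + V`:
`Ŝ_a(γ) = (1/|V|) Σ_{v ∈ V} 1_S(a + v) (-1)^{γ · v}`. -/
noncomputable def fourierOn {n : ℕ} (V : Submodule (ZMod 2) (Vec n))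
    (S : Set (Vec n)) (a γ : Vec n) : ℝ :=
  (∑ v : Vec n, Set.indicator (V : Set (Vec n))
      (fun v => Set.indicator S (fun _ => (1 : ℝ)) (a + v) * sgn (dot γ v)) v)
    / (Nat.card V : ℝ)

/-- Triples of vectors, the sample space of the `n`-fold GHZ query distribution. -/
abbrev Trip (n : ℕ) := Vec n × Vec n × Vec n

/-- Given an assignment of a subspace `W p` and a shift triple `b p` to each point `p`,
`partOf W b p` is the product of cosets `((b p).1 + W p) × ((b p).2.1 + W p) × ((b p).2.2 + W p)`. -/
def partOf {n : ℕ} (W : Trip n → Submodule (ZMod 2) (Vec n)) (b : Trip n → Trip n)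
    (p : Trip n) : Set (Trip n) :=
  {q | q.1 - (b p).1 ∈ W p ∧ q.2.1 - (b p).2.1 ∈ W p ∧ q.2.2 - (b p).2.2 ∈ W p}

section Fourier

variable {n : ℕ}

lemma dot_add (γ v w : Vec n) : dot γ (v + w) = dot γ v + dot γ w := by
  simp [dot, mul_add, Finset.sum_add_distrib]

lemma dot_zero_left (v : Vec n) : dot 0 v = 0 := by simp [dot]

lemma sgn_add (s t : ZMod 2) : sgn (s + t) = sgn s * sgn t := by
  have key : ∀ s t : ZMod 2, s + t = 0 ↔ s = t := by decide
  have h01 : ∀ s : ZMod 2, s = 0 ∨ s = 1 := by decide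
  rcases h01 s with rfl | rfl <;> rcases h01 t with rfl | rfl <;> simp [sgn, key]

lemma abs_sgn (t : ZMod 2) : |sgn t| = 1 := by
  unfold sgn; split_ifs <;> simp

lemma vec_add_self (v : Vec n) : v + v = 0 := by
  ext i; exact CharTwo.add_self_eq_zero _

/-- The hyperplane (or whole space) of vectors annihilated by the character `γ`. -/
def dotKer (γ : Vec n) : Submodule (ZMod 2) (Vec n) :=
  LinearMap.ker (dotProductBilin (ZMod 2) (ZMod 2) γ)

lemma mem_dotKer {γ v : Vec n} : v ∈ dotKer γ ↔ dot γ v = 0 := by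
  simp [dotKer, dot, dotProduct]

lemma finrank_le_finrank_inf_dotKer (V : Submodule (ZMod 2) (Vec n)) (γ : Vec n) :
    Module.finrank (ZMod 2) V ≤ Module.finrank (ZMod 2) (V ⊓ dotKer γ : Submodule _ _) + 1 := by
  have h1 := Submodule.finrank_sup_add_finrank_inf_eq V (dotKer γ)
  have h2 := LinearMap.finrank_range_add_finrank_ker
    (dotProductBilin (ZMod 2) (ZMod 2) γ : Vec n →ₗ[ZMod 2] ZMod 2)
  have h3 := Submodule.finrank_le (V ⊔ dotKer γ)
  have h4 := Submodule.finrank_le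
    (LinearMap.range (dotProductBilin (ZMod 2) (ZMod 2) γ : Vec n →ₗ[ZMod 2] ZMod 2))
  rw [Module.finrank_self] at h4
  change _ + Module.finrank (ZMod 2) (dotKer γ) = Module.finrank (ZMod 2) (Vec n) at h2
  omega

open Classical in
lemma fourierOn_eq_sum_filter (V : Submodule (ZMod 2) (Vec n)) (S : Set (Vec n)) (a γ : Vec n) :
    fourierOn V S a γ = (∑ v : Vec n, if v ∈ V then
      (if a + v ∈ S then (1 : ℝ) else 0) * sgn (dot γ v) else 0) / (Nat.card V : ℝ) := by
  simp [fourierOn, Set.indicator_apply]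

open Classical in
lemma card_submodule_eq_sum (V : Submodule (ZMod 2) (Vec n)) :
    (Nat.card V : ℝ) = ∑ v : Vec n, if v ∈ V then (1 : ℝ) else 0 := by
  rw [Finset.sum_boole, Nat.card_eq_fintype_card, Fintype.card_subtype]

lemma card_submodule_pos (V : Submodule (ZMod 2) (Vec n)) : (0 : ℝ) < Nat.card V := by
  exact_mod_cast Nat.card_pos

lemma fourierOn_add (V : Submodule (ZMod 2) (Vec n)) (S : Set (Vec n)) (a γ : Vec n)
    {w : Vec n} (hw : w ∈ V) :
    fourierOn V S (a + w) γ = sgn (dot γ w) * fourierOn V S a γ := by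
  classical
  rw [fourierOn_eq_sum_filter, fourierOn_eq_sum_filter, ← mul_div_assoc, Finset.mul_sum,
    ← Equiv.sum_comp (Equiv.addRight w)]
  congr 1
  refine Finset.sum_congr rfl fun v _ => ?_
  have e : a + w + (v + w) = a + v := by
    rw [add_add_add_comm, add_assoc, vec_add_self, add_zero]
  have e2 : v + w ∈ V ↔ v ∈ V := Submodule.add_mem_iff_left V hw
  simp only [Equiv.coe_addRight, e, e2, dot_add, sgn_add]
  split_ifs <;> ring

lemma abs_fourierOn_le_one (V : Submodule (ZMod 2) (Vec n)) (S : Set (Vec n)) (a γ : Vec n) :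
    |fourierOn V S a γ| ≤ 1 := by
  classical
  rw [fourierOn_eq_sum_filter, abs_div, abs_of_pos (card_submodule_pos V),
    div_le_one (card_submodule_pos V), card_submodule_eq_sum]
  refine (Finset.abs_sum_le_sum_abs _ _).trans (Finset.sum_le_sum fun v _ => ?_)
  split_ifs <;> simp [abs_sgn]

lemma sum_sgn_eq_zero (V : Submodule (ZMod 2) (Vec n)) (γ : Vec n) [DecidablePred (· ∈ V)]
    (h : ∃ v ∈ V, dot γ v ≠ 0) : ∑ v : Vec n, (if v ∈ V then sgn (dot γ v) else 0) = 0 := by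
  obtain ⟨w, hw, hγ⟩ := h
  have : ∑ v : Vec n, (if v ∈ V then sgn (dot γ v) else 0)
      = -∑ v : Vec n, (if v ∈ V then sgn (dot γ v) else 0) := by
    conv_lhs => rw [← Equiv.sum_comp (Equiv.addRight w)]
    rw [← Finset.sum_neg_distrib]
    refine Finset.sum_congr rfl fun v _ => ?_
    have e2 : v + w ∈ V ↔ v ∈ V := Submodule.add_mem_iff_left V hw
    have e3 : sgn (dot γ w) = -1 := by simp [sgn, hγ]
    simp only [Equiv.coe_addRight, e2, dot_add, sgn_add, e3]
    split_ifs <;> ring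
  linarith

/-- The Fourier coefficient of `S` on `a + V` at `γ`, set to `0` if `γ` is trivial on `V`. -/
noncomputable def nontrivialCoeff (V : Submodule (ZMod 2) (Vec n)) (S : Set (Vec n))
    (a γ : Vec n) : ℝ :=
  open Classical in if ∃ v ∈ V, dot γ v ≠ 0 then fourierOn V S a γ else 0

lemma fourierOn_inf_dotKer (V : Submodule (ZMod 2) (Vec n)) (S : Set (Vec n)) (a γ : Vec n) :
    fourierOn (V ⊓ dotKer γ) S a 0 = fourierOn V S a 0 + nontrivialCoeff V S a γ := by
  classical
  unfold nontrivialCoeff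
  split_ifs with h
  · have key : ∀ f : Vec n → ℝ, ∑ v, (if v ∈ V ⊓ dotKer γ then f v else 0)
        = (∑ v, (if v ∈ V then f v else 0)
          + ∑ v, (if v ∈ V then f v * sgn (dot γ v) else 0)) / 2 := by
      intro f
      rw [← Finset.sum_add_distrib, Finset.sum_div]
      refine Finset.sum_congr rfl fun v _ => ?_
      by_cases hv : v ∈ V <;> by_cases hd : dot γ v = 0 <;> simp [hv, hd, mem_dotKer, sgn]
    have hcard : (Nat.card (V ⊓ dotKer γ : Submodule _ _) : ℝ) = Nat.card V / 2 := by
      rw [card_submodule_eq_sum, key, card_submodule_eq_sum]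
      simp only [one_mul]
      rw [sum_sgn_eq_zero V γ h, add_zero]
    have hpos := card_submodule_pos V
    simp only [fourierOn_eq_sum_filter, key, hcard, dot_zero_left]
    simp only [sgn, if_true, mul_one]
    field_simp
  · push Not at h
    have : V ⊓ dotKer γ = V := inf_eq_left.2 fun v hv => mem_dotKer.2 (h v hv)
    rw [this, add_zero]

lemma sum_eq_zero_of_involutive {A : Type*} [Fintype A] (f : A → ℝ) (σ : A → A)
    (hσ : Function.Involutive σ) (hf : ∀ p, f (σ p) = -f p) : ∑ p, f p = 0 := by
  have h := Equiv.sum_comp hσ.toPerm f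
  simp only [Function.Involutive.coe_toPerm, hf, Finset.sum_neg_distrib] at h
  linarith

open Classical in
/-- A vector of `V` on which the character `γ` is nontrivial, or `0` if there is none. -/
noncomputable def flipVec (V : Submodule (ZMod 2) (Vec n)) (γ : Vec n) : Vec n :=
  if h : ∃ v ∈ V, dot γ v ≠ 0 then h.choose else 0

lemma flipVec_mem (V : Submodule (ZMod 2) (Vec n)) (γ : Vec n) : flipVec V γ ∈ V := by
  unfold flipVec
  split_ifs with h
  · exact h.choose_spec.1
  · exact zero_mem _

lemma nontrivialCoeff_add_flipVec (V : Submodule (ZMod 2) (Vec n)) (S : Set (Vec n))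
    (a γ : Vec n) :
    nontrivialCoeff V S (a + flipVec V γ) γ = -nontrivialCoeff V S a γ := by
  unfold nontrivialCoeff
  split_ifs with h
  · rw [fourierOn_add _ _ _ _ (flipVec_mem V γ)]
    have : dot γ (flipVec V γ) ≠ 0 := by
      rw [flipVec, dif_pos h]; exact h.choose_spec.2
    simp [sgn, this]
  · simp

/-- Cutting every coset along its character `Γ` increases the sum of the squared densities
by the sum of the squared nontrivial coefficients. -/
lemma sum_sq_density_inf_dotKer (U : Vec n × Vec n → Submodule (ZMod 2) (Vec n))
    (Γ : Vec n × Vec n → Vec n)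
    (hU : ∀ p u, u.1 ∈ U p → u.2 ∈ U p → U (p + u) = U p ∧ Γ (p + u) = Γ p)
    (S : Set (Vec n)) (π : Vec n × Vec n →+ Vec n) (ι : Vec n →+ Vec n × Vec n)
    (hι : ∀ (V : Submodule (ZMod 2) (Vec n)) (v), v ∈ V → (ι v).1 ∈ V ∧ (ι v).2 ∈ V)
    (hπ : ∀ v, π (ι v) = v) :
    ∑ p, fourierOn (U p ⊓ dotKer (Γ p)) S (π p) 0 ^ 2
      = ∑ p, fourierOn (U p) S (π p) 0 ^ 2
        + ∑ p, nontrivialCoeff (U p) S (π p) (Γ p) ^ 2 := by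
  let σ : Vec n × Vec n → Vec n × Vec n := fun p => p + ι (flipVec (U p) (Γ p))
  have hσU : ∀ p, U (σ p) = U p ∧ Γ (σ p) = Γ p := fun p =>
    hU p _ (hι _ _ (flipVec_mem _ _)).1 (hι _ _ (flipVec_mem _ _)).2
  have hσ : Function.Involutive σ := by
    intro p
    change σ p + ι (flipVec (U (σ p)) (Γ (σ p))) = p
    rw [(hσU p).1, (hσU p).2]
    change p + ι _ + ι _ = p
    rw [add_assoc, ← map_add, vec_add_self, map_zero, add_zero]
  have cross : ∑ p, 2 * fourierOn (U p) S (π p) 0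
      * nontrivialCoeff (U p) S (π p) (Γ p) = 0 := by
    refine sum_eq_zero_of_involutive _ σ hσ fun p => ?_
    have e : π (σ p) = π p + flipVec (U p) (Γ p) := by
      change π (p + ι _) = _
      rw [map_add, hπ]
    rw [(hσU p).1, (hσU p).2, e, nontrivialCoeff_add_flipVec,
      fourierOn_add _ _ _ _ (flipVec_mem _ _), dot_zero_left]
    simp [sgn]
  simp only [fourierOn_inf_dotKer, add_sq, Finset.sum_add_distrib]
  rw [cross, add_zero]

end Fourier

section Refinement

variable {n : ℕ}

/-- The GHZ triple `(x, y, x + y)` determined by its first two coordinates. -/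
def ghzTrip (p : Vec n × Vec n) : Trip n := (p.1, p.2, p.1 + p.2)

/-- `W` is constant on each product of cosets that it defines. -/
def IsCosetPartition (W : Trip n → Submodule (ZMod 2) (Vec n)) : Prop :=
  ∀ p q : Trip n, q ∈ partOf W id p → W q = W p

/-- The character `γ` is nontrivial on the part of `p` and has a large coefficient there. -/
def IsLargeChar (E1 E2 E3 : Set (Vec n)) (δ : ℝ) (W : Trip n → Submodule (ZMod 2) (Vec n))
    (p : Trip n) (γ : Vec n) : Prop :=
  (∃ v ∈ W p, dot γ v ≠ 0) ∧ (δ < |fourierOn (W p) E1 p.1 γ| ∨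
    δ < |fourierOn (W p) E2 p.2.1 γ| ∨ δ < |fourierOn (W p) E3 p.2.2 γ|)

open Classical in
/-- A character satisfying `B`, or `0` if there is none. -/
noncomputable def pickChar (B : Vec n → Prop) : Vec n :=
  if h : ∃ γ, B γ then h.choose else 0

/-- Cut every part that has a large character along one such character. -/
noncomputable def cutLarge (E1 E2 E3 : Set (Vec n)) (δ : ℝ)
    (W : Trip n → Submodule (ZMod 2) (Vec n)) (p : Trip n) : Submodule (ZMod 2) (Vec n) :=
  W p ⊓ dotKer (pickChar (IsLargeChar E1 E2 E3 δ W p))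

/-- The total squared density of the sets on the parts containing GHZ triples. -/
noncomputable def energy (E1 E2 E3 : Set (Vec n))
    (W : Trip n → Submodule (ZMod 2) (Vec n)) : ℝ :=
  ∑ p : Vec n × Vec n, fourierOn (W (ghzTrip p)) E1 p.1 0 ^ 2
    + ∑ p : Vec n × Vec n, fourierOn (W (ghzTrip p)) E2 p.2 0 ^ 2
    + ∑ p : Vec n × Vec n, fourierOn (W (ghzTrip p)) E3 (p.1 + p.2) 0 ^ 2

lemma abs_fourierOn_of_sub_mem {V : Submodule (ZMod 2) (Vec n)} {a b : Vec n} (h : b - a ∈ V)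
    (S : Set (Vec n)) (γ : Vec n) : |fourierOn V S b γ| = |fourierOn V S a γ| := by
  rw [← add_sub_cancel a b, fourierOn_add _ _ _ _ h, abs_mul, abs_sgn, one_mul]

lemma isLargeChar_eq {E1 E2 E3 : Set (Vec n)} {δ : ℝ}
    {W : Trip n → Submodule (ZMod 2) (Vec n)} (hW : IsCosetPartition W) {p q : Trip n}
    (hq : q ∈ partOf W id p) : IsLargeChar E1 E2 E3 δ W q = IsLargeChar E1 E2 E3 δ W p := by
  funext γ
  obtain ⟨h1, h2, h3⟩ := id hq
  simp only [IsLargeChar, hW p q hq, abs_fourierOn_of_sub_mem h1, abs_fourierOn_of_sub_mem h2,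
    abs_fourierOn_of_sub_mem h3, id]

lemma isCosetPartition_cutLarge {W : Trip n → Submodule (ZMod 2) (Vec n)}
    (hW : IsCosetPartition W) (E1 E2 E3 : Set (Vec n)) (δ : ℝ) :
    IsCosetPartition (cutLarge E1 E2 E3 δ W) := by
  rintro p q ⟨h1, h2, h3⟩
  have hq : q ∈ partOf W id p := ⟨h1.1, h2.1, h3.1⟩
  rw [cutLarge, cutLarge, isLargeChar_eq hW hq, hW p q hq]

lemma IsCosetPartition.partOf_eq {W : Trip n → Submodule (ZMod 2) (Vec n)}
    (hW : IsCosetPartition W) {p q : Trip n} (hq : q ∈ partOf W id p) :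
    partOf W id q = partOf W id p := by
  obtain ⟨h1, h2, h3⟩ := id hq
  have key : ∀ {a b : Vec n} (c : Vec n), b - a ∈ W p → (c - b ∈ W p ↔ c - a ∈ W p) := by
    intro a b c h
    rw [← sub_add_sub_cancel c b a, Submodule.add_mem_iff_left _ h]
  ext r
  simp only [partOf, Set.mem_ofPred_eq, hW p q hq, id]
  exact and_congr (key _ h1) (and_congr (key _ h2) (key _ h3))

open Classical in
lemma energy_cutLarge {W : Trip n → Submodule (ZMod 2) (Vec n)} (hW : IsCosetPartition W)
    (E1 E2 E3 : Set (Vec n)) {δ : ℝ} (hδ : 0 < δ) :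
    energy E1 E2 E3 W + δ ^ 2 * (Finset.univ.filter fun p : Vec n × Vec n =>
        ∃ γ, IsLargeChar E1 E2 E3 δ W (ghzTrip p) γ).card
      ≤ energy E1 E2 E3 (cutLarge E1 E2 E3 δ W) := by
  set Γ : Vec n × Vec n → Vec n := fun p => pickChar (IsLargeChar E1 E2 E3 δ W (ghzTrip p)) with hΓ
  have hU : ∀ p u : Vec n × Vec n, u.1 ∈ W (ghzTrip p) → u.2 ∈ W (ghzTrip p) →
      W (ghzTrip (p + u)) = W (ghzTrip p) ∧ Γ (p + u) = Γ p := by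
    intro p u h1 h2
    have hq : ghzTrip (p + u) ∈ partOf W id (ghzTrip p) := by
      refine ⟨?_, ?_, ?_⟩
      · simpa [ghzTrip] using h1
      · simpa [ghzTrip] using h2
      · have : p.1 + u.1 + (p.2 + u.2) - (p.1 + p.2) = u.1 + u.2 := by abel
        simpa [ghzTrip, this] using add_mem h1 h2
    exact ⟨hW _ _ hq, by simp only [hΓ, isLargeChar_eq hW hq]⟩
  have k1 := sum_sq_density_inf_dotKer (fun p => W (ghzTrip p)) Γ hU E1
    (AddMonoidHom.fst _ _) (AddMonoidHom.inl _ _) (fun V v hv => ⟨hv, zero_mem _⟩) (fun v => rfl)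
  have k2 := sum_sq_density_inf_dotKer (fun p => W (ghzTrip p)) Γ hU E2
    (AddMonoidHom.snd _ _) (AddMonoidHom.inr _ _) (fun V v hv => ⟨zero_mem _, hv⟩) (fun v => rfl)
  have k3 := sum_sq_density_inf_dotKer (fun p => W (ghzTrip p)) Γ hU E3
    (AddMonoidHom.fst _ _ + AddMonoidHom.snd _ _) (AddMonoidHom.inl _ _)
    (fun V v hv => ⟨hv, zero_mem _⟩) (fun v => add_zero v)
  simp only [AddMonoidHom.coe_fst, AddMonoidHom.coe_snd, AddMonoidHom.add_apply] at k1 k2 k3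
  simp only [energy, cutLarge]
  rw [k1, k2, k3]
  have gain : δ ^ 2 * ((Finset.univ.filter fun p : Vec n × Vec n =>
        ∃ γ, IsLargeChar E1 E2 E3 δ W (ghzTrip p) γ).card : ℝ)
      ≤ ∑ p : Vec n × Vec n, (nontrivialCoeff (W (ghzTrip p)) E1 p.1 (Γ p) ^ 2
        + nontrivialCoeff (W (ghzTrip p)) E2 p.2 (Γ p) ^ 2
        + nontrivialCoeff (W (ghzTrip p)) E3 (p.1 + p.2) (Γ p) ^ 2) := by
    rw [Finset.card_filter, Nat.cast_sum, Finset.mul_sum]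
    refine Finset.sum_le_sum fun p _ => ?_
    split_ifs with h
    · have hs : IsLargeChar E1 E2 E3 δ W (ghzTrip p) (Γ p) := by
        simp only [hΓ, pickChar, dif_pos h]; exact h.choose_spec
      obtain ⟨hv, hl⟩ := hs
      simp only [nontrivialCoeff, if_pos hv, Nat.cast_one, mul_one]
      have sq : ∀ {c : ℝ}, δ < |c| → δ ^ 2 ≤ c ^ 2 := fun {c} h => by
        rw [← sq_abs c]; exact pow_le_pow_left₀ hδ.le h.le 2
      have n1 := sq_nonneg (fourierOn (W (ghzTrip p)) E1 p.1 (Γ p))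
      have n2 := sq_nonneg (fourierOn (W (ghzTrip p)) E2 p.2 (Γ p))
      have n3 := sq_nonneg (fourierOn (W (ghzTrip p)) E3 (p.1 + p.2) (Γ p))
      rcases hl with h | h | h
      all_goals
        have := sq h
        simp only [ghzTrip] at this n1 n2 n3 ⊢
        linarith
    · simp only [Nat.cast_zero, mul_zero]
      positivity
  rw [Finset.sum_add_distrib, Finset.sum_add_distrib] at gain
  linarith

lemma card_vec_prod : (Fintype.card (Vec n × Vec n) : ℝ) = 2 ^ (2 * n) := by
  simp [Fintype.card_prod, two_mul, pow_add]

lemma energy_le (E1 E2 E3 : Set (Vec n)) (W : Trip n → Submodule (ZMod 2) (Vec n)) :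
    energy E1 E2 E3 W ≤ 3 * 2 ^ (2 * n) := by
  have key : ∀ (S : Set (Vec n)) (π : Vec n × Vec n → Vec n),
      ∑ p : Vec n × Vec n, fourierOn (W (ghzTrip p)) S (π p) 0 ^ 2 ≤ 2 ^ (2 * n) := by
    intro S π
    rw [← card_vec_prod]
    calc _ ≤ ∑ _p : Vec n × Vec n, (1 : ℝ) :=
          Finset.sum_le_sum fun p _ => (sq_le_one_iff_abs_le_one _).2 (abs_fourierOn_le_one _ _ _ _)
      _ = _ := by simp
  have h1 := key E1 Prod.fst
  have h2 := key E2 Prod.snd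
  have h3 := key E3 fun p => p.1 + p.2
  unfold energy
  linarith

open Classical in
/-- Some coset partition of codimension at most `3 / δ ^ 3` has parts with a large character
only on a `δ` fraction of the GHZ triples. -/
lemma exists_isCosetPartition (E1 E2 E3 : Set (Vec n)) {δ : ℝ} (hδ : 0 < δ) :
    ∃ W : Trip n → Submodule (ZMod 2) (Vec n), IsCosetPartition W ∧
      (∀ p, (n : ℝ) - Module.finrank (ZMod 2) (W p) ≤ 3 / δ ^ 3) ∧
      ((Finset.univ.filter fun p : Vec n × Vec n =>
        ∃ γ, IsLargeChar E1 E2 E3 δ W (ghzTrip p) γ).card : ℝ) ≤ δ * 2 ^ (2 * n) := by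
  by_contra hcon
  push Not at hcon
  have hN : (0 : ℝ) < 2 ^ (2 * n) := by positivity
  have hd3 : 0 < δ ^ 3 := by positivity
  have bound : ∀ (k : ℕ) (W : Trip n → Submodule (ZMod 2) (Vec n)),
      k * δ ^ 3 * 2 ^ (2 * n) ≤ energy E1 E2 E3 W → (k : ℝ) ≤ 3 / δ ^ 3 := by
    intro k W h
    rw [le_div_iff₀ hd3]
    exact le_of_mul_le_mul_right (h.trans (energy_le E1 E2 E3 W)) hN
  have step : ∀ k : ℕ, ∃ W : Trip n → Submodule (ZMod 2) (Vec n), IsCosetPartition W ∧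
      (∀ p, n ≤ Module.finrank (ZMod 2) (W p) + k) ∧
      k * δ ^ 3 * 2 ^ (2 * n) ≤ energy E1 E2 E3 W := by
    intro k
    induction k with
    | zero =>
      refine ⟨fun _ => ⊤, fun _ _ _ => rfl, fun p => by simp, ?_⟩
      unfold energy
      simp only [Nat.cast_zero, zero_mul]
      positivity
    | succ k ih =>
      obtain ⟨W, hW, hdim, hen⟩ := ih
      refine ⟨cutLarge E1 E2 E3 δ W, isCosetPartition_cutLarge hW E1 E2 E3 δ, fun p => ?_, ?_⟩
      · have h1 := finrank_le_finrank_inf_dotKer (W p)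
          (pickChar (IsLargeChar E1 E2 E3 δ W p))
        have h2 := hdim p
        unfold cutLarge
        omega
      · have h1 := energy_cutLarge hW E1 E2 E3 hδ
        have h2 := hcon W hW fun p => by
          have h3 : (n : ℝ) ≤ Module.finrank (ZMod 2) (W p) + k := by exact_mod_cast hdim p
          linarith [bound k W hen]
        have h4 := mul_le_mul_of_nonneg_left h2.le (sq_nonneg δ)
        push_cast
        linarith
  obtain ⟨k, hk⟩ := exists_nat_gt (3 / δ ^ 3)
  obtain ⟨W, -, -, hen⟩ := step k
  exact absurd (bound k W hen) (not_le.2 hk)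

end Refinement

/-- Pseudorandom affine partition: there is a partition of `(F_2^n)^3` into products of
cosets of subspaces of codimension at most `3/δ³` such that, with probability at least
`1 - δ/α` over `(x, y, z) ∼ P|E`, on the part containing `(x, y, z)` all nonzero Fourier
coefficients of `E1, E2, E3` (restricted to the respective cosets) are at most `δ`. -/
theorem ghz_pseudorandom_partition {n : ℕ} (E1 E2 E3 : Set (Vec n)) (α δ : ℝ)
    (hα : 0 < α) (hδ : 0 < δ)
    (hPE : (Nat.card {p : Vec n × Vec n // p.1 ∈ E1 ∧ p.2 ∈ E2 ∧ p.1 + p.2 ∈ E3} : ℝ)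
      / (2 : ℝ) ^ (2 * n) = α) :
    ∃ (W : Trip n → Submodule (ZMod 2) (Vec n)) (b : Trip n → Trip n),
      -- each point belongs to the part assigned to it
      (∀ p : Trip n, p ∈ partOf W b p) ∧
      -- the parts form a partition of the space
      (∀ p q : Trip n, q ∈ partOf W b p → partOf W b q = partOf W b p) ∧
      -- each subspace has codimension at most `3/δ³`
      (∀ p : Trip n, (n : ℝ) - (Module.finrank (ZMod 2) (W p) : ℝ) ≤ 3 / δ ^ 3) ∧
      -- with probability ≥ 1 - δ/α over a sample from P|E, the part containing the sample
      -- has all nonzero Fourier coefficients of E1, E2, E3 bounded by δ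
      (1 - δ / α ≤
        (Nat.card {p : Vec n × Vec n // p.1 ∈ E1 ∧ p.2 ∈ E2 ∧ p.1 + p.2 ∈ E3 ∧
          (∀ γ : Vec n, (∃ v ∈ W (p.1, p.2, p.1 + p.2), dot γ v ≠ 0) →
            (|fourierOn (W (p.1, p.2, p.1 + p.2)) E1 ((b (p.1, p.2, p.1 + p.2)).1) γ| ≤ δ ∧
             |fourierOn (W (p.1, p.2, p.1 + p.2)) E2 ((b (p.1, p.2, p.1 + p.2)).2.1) γ| ≤ δ ∧
             |fourierOn (W (p.1, p.2, p.1 + p.2)) E3 ((b (p.1, p.2, p.1 + p.2)).2.2) γ| ≤ δ))} : ℝ)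
        / (Nat.card {p : Vec n × Vec n // p.1 ∈ E1 ∧ p.2 ∈ E2 ∧ p.1 + p.2 ∈ E3} : ℝ)) := by
  classical
  obtain ⟨W, hW, hcodim, hbad⟩ := exists_isCosetPartition E1 E2 E3 hδ
  refine ⟨W, id, fun p => by simp [partOf], fun p q hq => hW.partOf_eq hq, hcodim, ?_⟩
  simp only [Nat.card_eq_fintype_card, Fintype.card_subtype] at hPE ⊢
  have hN : (0 : ℝ) < 2 ^ (2 * n) := by positivity
  have hE := (div_eq_iff hN.ne').1 hPE
  rw [hE, le_div_iff₀ (by positivity)]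
  have hα' : (1 - δ / α) * (α * 2 ^ (2 * n)) = α * 2 ^ (2 * n) - δ * 2 ^ (2 * n) := by
    field_simp
  rw [hα', ← hE, sub_le_iff_le_add]
  refine le_trans ?_ (add_le_add_right hbad _)
  rw [← Nat.cast_add, Nat.cast_le]
  refine le_trans (Finset.card_le_card fun p hp => ?_) (Finset.card_union_le _ _)
  obtain ⟨h1, h2, h3⟩ := (Finset.mem_filter.1 hp).2
  rw [Finset.mem_union, Finset.mem_filter, Finset.mem_filter]
  by_cases hb : ∃ γ, IsLargeChar E1 E2 E3 δ W (ghzTrip p) γ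
  · exact Or.inr ⟨Finset.mem_univ _, hb⟩
  · refine Or.inl ⟨Finset.mem_univ _, h1, h2, h3, fun γ hγ => ?_⟩
    by_contra hc
    refine hb ⟨γ, hγ, ?_⟩
    by_contra hl
    push Not at hl
    exact hc hl
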